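/- (Uniqueness) Let T be an anonymous and reasonable cardinal comparison test. If T is not equivalent to the finite derivative test D (i.e., T ≁ D), then T is not error-free. -/

import Mathlib

open MeasureTheory Filter Set
open scoped ENNReal

/-- The space Ω^∞ of infinite binary sequences. -/
abbrev BinSeq : Type := ℕ → Bool

/-- The cylinder set `[ω^t]` of sequences agreeing with `ω` in the first `t` coordinates. -/
def cyl (ω : BinSeq) (t : ℕ) : Set BinSeq := {ω' | ∀ i < t, ω' i = ω i}

/-- A (candidate) cardinal comparison test: to each ordered pair of measures, each time `t`
and each realization `ω` it assigns a number. -/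
abbrev Test : Type := Measure BinSeq → Measure BinSeq → ℕ → BinSeq → ℝ

/-- The σ-algebra on `BinSeq` generated by the first `t` coordinates. -/
def coordAlg (t : ℕ) : MeasurableSpace BinSeq :=
  MeasurableSpace.comap (fun ω (i : Fin t) => ω (i : ℕ)) inferInstance

/-- A cardinal comparison test: values in `[0,1]`, and `T_t` is measurable with respect to the
σ-algebra generated by the first `t` coordinates, for every `t ≥ 1`. -/
def IsCCTest (T : Test) : Prop :=
  ∀ f g : Measure BinSeq, IsProbabilityMeasure f → IsProbabilityMeasure g →
    ∀ t : ℕ, 1 ≤ t →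
      (∀ ω, T f g t ω ∈ Set.Icc (0:ℝ) 1) ∧ @Measurable BinSeq ℝ (coordAlg t) _ (T f g t)

/-- `L_{T,ε}^{(f,g)}`: the set of `ω` where `lim_t T_t(ω,f,g)` exists and is `> ε`. -/
def LSet (T : Test) (f g : Measure BinSeq) (ε : ℝ) : Set BinSeq :=
  {ω | ∃ l : ℝ, Tendsto (fun t => T f g t ω) atTop (nhds l) ∧ ε < l}

/-- `R_{T,ε}^{(f,g)}`: the set of `ω` where `lim_t T_t(ω,f,g)` exists and is `< ε`. -/
def RSet (T : Test) (f g : Measure BinSeq) (ε : ℝ) : Set BinSeq :=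
  {ω | ∃ l : ℝ, Tendsto (fun t => T f g t ω) atTop (nhds l) ∧ l < ε}

/-- Anonymity: `T_t(ω,f,g) = 1 - T_t(ω,g,f)`. -/
def Anonymous (T : Test) : Prop :=
  ∀ f g : Measure BinSeq, IsProbabilityMeasure f → IsProbabilityMeasure g →
    ∀ t : ℕ, 1 ≤ t → ∀ ω, T f g t ω = 1 - T g f t ω

/-- Error-freeness. -/
def ErrorFree (T : Test) : Prop :=
  ∀ f g : Measure BinSeq, IsProbabilityMeasure f → IsProbabilityMeasure g →
    ∀ A : Set BinSeq, MeasurableSet A →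
      (∀ ε : ℝ, ε ∈ Set.Ioo 0 (1/2) →
        f (A ∩ RSet T f g ε) ≤ ENNReal.ofReal (ε / (1 - ε)) * g (A ∩ RSet T f g ε)) ∧
      (∀ ε : ℝ, ε ∈ Set.Ioo (1/2) 1 →
        g (A ∩ LSet T f g ε) ≤ ENNReal.ofReal ((1 - ε) / ε) * f (A ∩ LSet T f g ε))

/-- Reasonableness. -/
def Reasonable (T : Test) : Prop :=
  ∀ f g : Measure BinSeq, IsProbabilityMeasure f → IsProbabilityMeasure g →
    ∀ A : Set BinSeq, MeasurableSet A →
      (∀ ε : ℝ, ε ∈ Set.Ioo 0 (1/2) →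
        0 < g A → f A < ENNReal.ofReal (ε / (1 - ε)) * g A →
          0 < g (A ∩ RSet T f g ε)) ∧
      (∀ ε : ℝ, ε ∈ Set.Ioo (1/2) 1 →
        0 < f A → g A < ENNReal.ofReal ((1 - ε) / ε) * f A →
          0 < f (A ∩ LSet T f g ε))

/-- The finite derivative test `D`. -/
noncomputable def Dtest : Test := fun f g t ω =>
  match t with
  | 0 => 1/2
  | Nat.succ s =>
      if 0 < f (cyl ω s) + g (cyl ω s) then
        (f (cyl ω s)).toReal / ((f (cyl ω s)).toReal + (g (cyl ω s)).toReal)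
      else 1/2


/-- Two tests are equivalent at a pair `(f,g)` if the set of realizations where both limits
exist and differ is null under both `f` and `g`. -/
def EquivAt (T T' : Test) (f g : Measure BinSeq) : Prop :=
  f {ω | ∃ l l' : ℝ, Tendsto (fun t => T f g t ω) atTop (nhds l) ∧
      Tendsto (fun t => T' f g t ω) atTop (nhds l') ∧ l ≠ l'} = 0 ∧
  g {ω | ∃ l l' : ℝ, Tendsto (fun t => T f g t ω) atTop (nhds l) ∧
      Tendsto (fun t => T' f g t ω) atTop (nhds l') ∧ l ≠ l'} = 0

/-- `T ∼ T'` : equivalence at every pair of probability measures. -/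
def TestEquiv (T T' : Test) : Prop :=
  ∀ f g : Measure BinSeq, IsProbabilityMeasure f → IsProbabilityMeasure g → EquivAt T T' f g

lemma coordAlg_le (t : ℕ) : coordAlg t ≤ (inferInstance : MeasurableSpace BinSeq) :=
  Measurable.comap_le (measurable_pi_lambda _ fun i => measurable_pi_apply (i : ℕ))

lemma measurable_coord_coordAlg {i t : ℕ} (h : i < t) :
    Measurable[coordAlg t] (fun ω : BinSeq => ω i) :=
  (measurable_pi_apply (X := fun _ : Fin t => Bool) ⟨i, h⟩).comp
    (comap_measurable fun (ω : BinSeq) (j : Fin t) => ω j)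

lemma coordAlg_mono : Monotone coordAlg := by
  intro s t hst
  refine Measurable.comap_le ?_
  exact @measurable_pi_lambda _ _ _ (coordAlg t) _ _
    fun i => measurable_coord_coordAlg (i.2.trans_le hst)

/-- The filtration of `BinSeq` by the first `t` coordinates. -/
def coordFiltration : Filtration ℕ (inferInstance : MeasurableSpace BinSeq) where
  seq := coordAlg
  mono' := coordAlg_mono
  le' := coordAlg_le

lemma iSup_coordFiltration :
    ⨆ t, coordFiltration t = (inferInstance : MeasurableSpace BinSeq) := by
  refine le_antisymm (iSup_le coordAlg_le) ?_
  refine iSup_le fun i => ?_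
  refine le_trans ?_ (le_iSup coordFiltration (i + 1))
  exact (measurable_coord_coordAlg (Nat.lt_succ_self i)).comap_le

lemma mem_cyl_self (ω : BinSeq) (t : ℕ) : ω ∈ cyl ω t := fun _ _ => rfl

lemma cyl_eq_preimage (ω : BinSeq) (t : ℕ) :
    cyl ω t = (fun ω' (i : Fin t) => ω' (i : ℕ)) ⁻¹' {fun i : Fin t => ω i} := by
  ext ω'
  simp only [cyl, mem_ofPred_eq, mem_preimage, mem_singleton_iff, funext_iff]
  exact ⟨fun h i => h i i.2, fun h i hi => h ⟨i, hi⟩⟩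

lemma measurableSet_coordAlg_cyl (ω : BinSeq) (t : ℕ) : MeasurableSet[coordAlg t] (cyl ω t) := by
  rw [cyl_eq_preimage]
  exact ⟨_, measurableSet_singleton _, rfl⟩

lemma isOpen_cyl (ω : BinSeq) (t : ℕ) : IsOpen (cyl ω t) := by
  rw [cyl_eq_preimage]
  exact (isOpen_discrete _).preimage (by fun_prop)

/-- A function measurable with respect to the first `t` coordinates is constant on cylinders. -/
lemma eq_of_mem_cyl {h : BinSeq → ℝ} {t : ℕ} (hh : Measurable[coordAlg t] h) {ω ω' : BinSeq}
    (hω : ω' ∈ cyl ω t) : h ω' = h ω := by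
  obtain ⟨s, -, hs⟩ := hh (measurableSet_singleton (h ω))
  have h1 : ω ∈ h ⁻¹' {h ω} := rfl
  rw [cyl_eq_preimage] at hω
  have h2 : ω' ∈ h ⁻¹' {h ω} := by
    rw [← hs] at h1 ⊢
    rw [mem_preimage] at h1 hω ⊢
    rw [mem_singleton_iff] at hω
    rwa [hω]
  exact h2

lemma ae_measure_cyl_ne_zero (ν : Measure BinSeq) : ∀ᵐ ω ∂ν, ∀ t, ν (cyl ω t) ≠ 0 := by
  rw [ae_all_iff]
  intro t
  rw [ae_iff]
  refine measure_null_of_locally_null _ fun ω hω => ⟨cyl ω t, ?_, ?_⟩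
  · exact mem_nhdsWithin_of_mem_nhds ((isOpen_cyl ω t).mem_nhds (mem_cyl_self ω t))
  · simpa using hω

/-- The density of `f` with respect to `f + g`. -/
noncomputable def density (f g : Measure BinSeq) (ω : BinSeq) : ℝ := (f.rnDeriv (f + g) ω).toReal

lemma measurable_density (f g : Measure BinSeq) : Measurable (density f g) :=
  (Measure.measurable_rnDeriv _ _).ennreal_toReal

lemma integrable_density (f g : Measure BinSeq) [IsFiniteMeasure f] : Integrable (density f g) (f + g) :=
  Measure.integrable_toReal_rnDeriv

lemma setIntegral_density (f g : Measure BinSeq) [IsProbabilityMeasure f] [IsProbabilityMeasure g]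
    (A : Set BinSeq) :
    ∫ ω in A, density f g ω ∂(f + g) = f.real A :=
  Measure.setIntegral_toReal_rnDeriv (Measure.AbsolutelyContinuous.rfl.add_right g) A

lemma condExp_density_mul (f g : Measure BinSeq) [IsProbabilityMeasure f] [IsProbabilityMeasure g]
    (t : ℕ) (ω : BinSeq) :
    ((f + g)[density f g | coordFiltration t]) ω * (f + g).real (cyl ω t)
      = f.real (cyl ω t) := by
  have hm := measurableSet_coordAlg_cyl ω t
  have hc : Measurable[coordAlg t] ((f + g)[density f g | coordFiltration t]) :=
    stronglyMeasurable_condExp.measurable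
  rw [← setIntegral_density f g (cyl ω t),
    ← setIntegral_condExp (coordFiltration.le t) (integrable_density f g) hm,
    setIntegral_congr_fun (coordFiltration.le t _ hm) fun ω' hω' => eq_of_mem_cyl hc hω',
    setIntegral_const, smul_eq_mul, mul_comm]

lemma tendsto_Dtest_density (f g : Measure BinSeq) [IsProbabilityMeasure f] [IsProbabilityMeasure g] :
    ∀ᵐ ω ∂(f + g), Tendsto (fun t => Dtest f g t ω) atTop (nhds (density f g ω)) := by
  have h1 := tendsto_ae_condExp (μ := f + g) (ℱ := coordFiltration) (density f g)
  rw [iSup_coordFiltration, condExp_of_stronglyMeasurable le_rfl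
    (measurable_density f g).stronglyMeasurable (integrable_density f g)] at h1
  filter_upwards [h1, ae_measure_cyl_ne_zero (f + g)] with ω hω hpos
  rw [← tendsto_add_atTop_iff_nat 1]
  refine hω.congr fun t => ?_
  have hp : 0 < f (cyl ω t) + g (cyl ω t) := pos_iff_ne_zero.2 (by simpa using hpos t)
  have hr : 0 < (f + g).real (cyl ω t) := ENNReal.toReal_pos (hpos t) (measure_ne_top _ _)
  have := condExp_density_mul f g t ω
  simp only [Dtest, if_pos hp]
  change _ = f.real _ / (f.real _ + g.real _)
  rw [← measureReal_add_apply, eq_div_iff hr.ne', this]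

lemma measure_eq_zero_of_lt_density (f g : Measure BinSeq) [IsProbabilityMeasure f] [IsProbabilityMeasure g]
    {B : Set BinSeq} (hB : MeasurableSet B) {ε : ℝ}
    (h : ∀ ω ∈ B, ε < density f g ω) (hle : f.real B ≤ ε * (f + g).real B) :
    (f + g) B = 0 := by
  by_contra h0
  have hi := (integrable_density f g).integrableOn (s := B)
  have hc : IntegrableOn (fun _ => ε) B (f + g) := (integrable_const ε).integrableOn
  have h1 : 0 < ∫ ω in B, (density f g ω - ε) ∂(f + g) := by
    rw [setIntegral_pos_iff_support_of_nonneg_ae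
      ((ae_restrict_mem hB).mono fun ω hω => sub_nonneg.2 (h ω hω).le) (hi.sub hc)]
    have : Function.support (fun ω => density f g ω - ε) ∩ B = B :=
      inter_eq_right.2 fun ω hω => (sub_pos.2 (h ω hω)).ne'
    rw [this]
    exact pos_iff_ne_zero.2 h0
  rw [integral_sub hi hc, setIntegral_density, setIntegral_const, smul_eq_mul] at h1
  linarith

lemma measure_eq_zero_of_density_lt (f g : Measure BinSeq) [IsProbabilityMeasure f] [IsProbabilityMeasure g]
    {B : Set BinSeq} (hB : MeasurableSet B) {ε : ℝ}
    (h : ∀ ω ∈ B, density f g ω < ε) (hle : ε * (f + g).real B ≤ f.real B) :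
    (f + g) B = 0 := by
  by_contra h0
  have hi := (integrable_density f g).integrableOn (s := B)
  have hc : IntegrableOn (fun _ => ε) B (f + g) := (integrable_const ε).integrableOn
  have h1 : 0 < ∫ ω in B, (ε - density f g ω) ∂(f + g) := by
    rw [setIntegral_pos_iff_support_of_nonneg_ae
      ((ae_restrict_mem hB).mono fun ω hω => sub_nonneg.2 (h ω hω).le) (hc.sub hi)]
    have : Function.support (fun ω => ε - density f g ω) ∩ B = B :=
      inter_eq_right.2 fun ω hω => (sub_pos.2 (h ω hω)).ne'
    rw [this]
    exact pos_iff_ne_zero.2 h0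
  rw [integral_sub hc hi, setIntegral_density, setIntegral_const, smul_eq_mul] at h1
  linarith

lemma measure_le_ofReal_mul_iff (f g : Measure BinSeq) [IsProbabilityMeasure f] [IsProbabilityMeasure g]
    {B : Set BinSeq} {ε : ℝ} (hε : ε ∈ Ioo (0 : ℝ) 1) :
    f B ≤ ENNReal.ofReal (ε / (1 - ε)) * g B ↔ f.real B ≤ ε * (f + g).real B := by
  have h1 : 0 < 1 - ε := sub_pos.2 hε.2
  rw [← ofReal_measureReal (μ := f), ← ofReal_measureReal (μ := g),
    ← ENNReal.ofReal_mul (div_pos hε.1 h1).le,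
    ENNReal.ofReal_le_ofReal_iff (by have := hε.1; positivity), measureReal_add_apply,
    div_mul_eq_mul_div, le_div_iff₀ h1]
  constructor <;> intro h <;> linarith

lemma measurableSet_RSet {T : Test} (hT : IsCCTest T) (f g : Measure BinSeq)
    [IsProbabilityMeasure f] [IsProbabilityMeasure g] (ε : ℝ) : MeasurableSet (RSet T f g ε) := by
  have hm : ∀ t, Measurable (T f g (t + 1)) := fun t =>
    (hT f g inferInstance inferInstance (t + 1) (by omega)).2.mono (coordAlg_le _) le_rfl
  have heq : RSet T f g ε = {ω | ∃ l, Tendsto (fun t => T f g (t + 1) ω) atTop (nhds l)} ∩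
      {ω | limsup (fun t => T f g (t + 1) ω) atTop < ε} := by
    ext ω
    constructor
    · rintro ⟨l, hl, hlt⟩
      rw [← tendsto_add_atTop_iff_nat 1] at hl
      exact ⟨⟨l, hl⟩, by rwa [mem_ofPred_eq, hl.limsup_eq]⟩
    · rintro ⟨⟨l, hl⟩, hlt⟩
      rw [mem_ofPred_eq, hl.limsup_eq] at hlt
      exact ⟨l, (tendsto_add_atTop_iff_nat 1).1 hl, hlt⟩
  rw [heq]
  exact (measurableSet_exists_tendsto hm).inter
    (measurableSet_lt (Measurable.limsup hm) measurable_const)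

lemma ErrorFree.ae_density_le {T : Test} (hE : ErrorFree T) (hT : IsCCTest T)
    (f g : Measure BinSeq) [IsProbabilityMeasure f] [IsProbabilityMeasure g] {ε : ℝ}
    (hε : ε ∈ Ioo (0 : ℝ) (1 / 2)) :
    ∀ᵐ ω ∂(f + g), ω ∈ RSet T f g ε → density f g ω ≤ ε := by
  have hA : MeasurableSet {ω | ε < density f g ω} :=
    measurableSet_lt measurable_const (measurable_density f g)
  have h := (hE f g inferInstance inferInstance _ hA).1 ε hε
  rw [measure_le_ofReal_mul_iff f g ⟨hε.1, hε.2.trans (by norm_num)⟩] at h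
  have h0 := measure_eq_zero_of_lt_density f g (hA.inter (measurableSet_RSet hT f g ε))
    (fun ω hω => hω.1) h
  rw [ae_iff]
  convert h0 using 2
  ext ω
  simp [and_comm]

lemma Reasonable.ae_mem_RSet {T : Test} (hR : Reasonable T) (hT : IsCCTest T)
    (f g : Measure BinSeq) [IsProbabilityMeasure f] [IsProbabilityMeasure g] {ε : ℝ}
    (hε : ε ∈ Ioo (0 : ℝ) (1 / 2)) :
    ∀ᵐ ω ∂(f + g), density f g ω < ε → ω ∈ RSet T f g ε := by
  have hA : MeasurableSet ({ω | density f g ω < ε} \ RSet T f g ε) :=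
    (measurableSet_lt (measurable_density f g) measurable_const).diff
      (measurableSet_RSet hT f g ε)
  have h := (hR f g inferInstance inferInstance _ hA).1 ε hε
  rw [sdiff_inter_self, measure_empty] at h
  have h0 : (f + g) ({ω | density f g ω < ε} \ RSet T f g ε) = 0 := by
    refine measure_eq_zero_of_density_lt f g hA (fun ω hω => hω.1) ?_
    by_contra! hlt
    have hlt' : f ({ω | density f g ω < ε} \ RSet T f g ε) <
        ENNReal.ofReal (ε / (1 - ε)) * g ({ω | density f g ω < ε} \ RSet T f g ε) := by
      by_contra! hle
      have h1 : 0 < 1 - ε := by linarith [hε.2]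
      rw [← ofReal_measureReal (μ := f), ← ofReal_measureReal (μ := g),
        ← ENNReal.ofReal_mul (div_pos hε.1 h1).le,
        ENNReal.ofReal_le_ofReal_iff measureReal_nonneg, div_mul_eq_mul_div,
        div_le_iff₀ h1] at hle
      rw [measureReal_add_apply] at hlt
      linarith
    exact lt_irrefl _ (h (pos_of_mul_pos_right (zero_le.trans_lt hlt') zero_le) hlt')
  rw [ae_iff]
  convert h0 using 2
  ext ω
  simp

/-- Almost surely, the two limits agree as soon as one of them is below `1/2`. -/
lemma ae_limit_eq_of_lt_half {T : Test} (hT : IsCCTest T) (hR : Reasonable T) (hE : ErrorFree T)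
    (f g : Measure BinSeq) [IsProbabilityMeasure f] [IsProbabilityMeasure g] :
    ∀ᵐ ω ∂(f + g), ∀ l d : ℝ, Tendsto (fun t => T f g t ω) atTop (nhds l) →
      Tendsto (fun t => Dtest f g t ω) atTop (nhds d) → l < 1 / 2 ∨ d < 1 / 2 → l = d := by
  have h1 : ∀ᵐ ω ∂(f + g), ∀ q : ℚ, (q : ℝ) ∈ Ioo (0 : ℝ) (1 / 2) →
      ω ∈ RSet T f g q → density f g ω ≤ q := by
    simp_rw [ae_all_iff]
    exact fun q hq => hE.ae_density_le hT f g hq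
  have h2 : ∀ᵐ ω ∂(f + g), ∀ q : ℚ, (q : ℝ) ∈ Ioo (0 : ℝ) (1 / 2) →
      density f g ω < q → ω ∈ RSet T f g q := by
    simp_rw [ae_all_iff]
    exact fun q hq => hR.ae_mem_RSet hT f g hq
  filter_upwards [h1, h2, tendsto_Dtest_density f g] with ω hle hmem hD l d hl hd hlt
  obtain rfl : d = density f g ω := tendsto_nhds_unique hd hD
  have hl0 : 0 ≤ l := ge_of_tendsto hl <| (eventually_ge_atTop 1).mono fun t ht =>
    ((hT f g inferInstance inferInstance t ht).1 ω).1
  have hd0 : 0 ≤ density f g ω := ENNReal.toReal_nonneg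
  have hdl : l < 1 / 2 → density f g ω ≤ l := by
    intro h
    by_contra! hc
    obtain ⟨q, hq1, hq2⟩ := exists_rat_btwn (lt_min h hc)
    exact absurd (hle q ⟨hl0.trans_lt hq1, hq2.trans_le (min_le_left _ _)⟩ ⟨l, hl, hq1⟩)
      (hq2.trans_le (min_le_right _ _)).not_ge
  have hld : density f g ω < 1 / 2 → l ≤ density f g ω := by
    intro h
    by_contra! hc
    obtain ⟨q, hq1, hq2⟩ := exists_rat_btwn (lt_min h hc)
    obtain ⟨l', hl', hlt'⟩ := hmem q ⟨hd0.trans_lt hq1, hq2.trans_le (min_le_left _ _)⟩ hq1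
    rw [tendsto_nhds_unique hl' hl] at hlt'
    exact absurd hlt' (hq2.trans_le (min_le_right _ _)).not_gt
  rcases hlt with h | h
  · exact le_antisymm (hld ((hdl h).trans_lt h)) (hdl h)
  · exact le_antisymm (hld h) (hdl ((hld h).trans_lt h))

lemma Dtest_anonymous : Anonymous Dtest := by
  intro f g hf hg t ht ω
  obtain ⟨s, rfl⟩ : ∃ s, t = s + 1 := ⟨t - 1, by omega⟩
  simp only [Dtest, add_comm (g (cyl ω s)), add_comm (g (cyl ω s)).toReal]
  split_ifs with h
  · have h' : 0 < (f (cyl ω s)).toReal + (g (cyl ω s)).toReal := by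
      rw [← ENNReal.toReal_add (measure_ne_top f _) (measure_ne_top g _)]
      exact ENNReal.toReal_pos h.ne' (by finiteness)
    field_simp
    ring
  · norm_num

lemma Anonymous.tendsto_swap {T : Test} (hT : Anonymous T) {f g : Measure BinSeq}
    [IsProbabilityMeasure f] [IsProbabilityMeasure g] {ω : BinSeq} {l : ℝ}
    (h : Tendsto (fun t => T f g t ω) atTop (nhds l)) :
    Tendsto (fun t => T g f t ω) atTop (nhds (1 - l)) :=
  (h.const_sub 1).congr' <| (eventually_ge_atTop 1).mono fun t ht =>
    (hT g f inferInstance inferInstance t ht ω).symm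

/-- An anonymous, reasonable and error-free test is equivalent to the finite derivative test. -/
lemma testEquiv_Dtest {T : Test} (hT : IsCCTest T) (hA : Anonymous T) (hR : Reasonable T)
    (hE : ErrorFree T) : TestEquiv T Dtest := by
  intro f g hf hg
  have h : ∀ᵐ ω ∂(f + g), ¬ ∃ l l' : ℝ, Tendsto (fun t => T f g t ω) atTop (nhds l) ∧
      Tendsto (fun t => Dtest f g t ω) atTop (nhds l') ∧ l ≠ l' := by
    have hswap := ae_limit_eq_of_lt_half hT hR hE g f
    rw [add_comm g f] at hswap
    filter_upwards [ae_limit_eq_of_lt_half hT hR hE f g, hswap] with ω h1 h2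
    rintro ⟨l, d, hl, hd, hne⟩
    have h3 := h1 l d hl hd
    have h4 := h2 _ _ (hA.tendsto_swap hl) (Dtest_anonymous.tendsto_swap hd)
    grind
  rw [ae_iff, Measure.add_apply, add_eq_zero] at h
  simpa only [EquivAt, not_not] using h

/-- Uniqueness: any anonymous reasonable cardinal comparison test which is not equivalent to
the finite derivative test is not error-free. -/
theorem stmt8 (T : Test) (hT : IsCCTest T) (hAnon : Anonymous T) (hReas : Reasonable T)
    (hne : ¬ TestEquiv T Dtest) : ¬ ErrorFree T :=
  fun hE => hne (testEquiv_Dtest hT hAnon hReas hE)
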